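/- arXiv:1404.3916 — 5 statements merged into one kernel-verified Lean document; each statement's English description precedes it below -/
import Mathlib

section
/- Let (K, v) be a valued field and let L/K be an algebraic field extension. Let w_1, …, w_n be pairwise distinct extensions of v to L, let a_i ∈ 𝒪_{w_i} for i = 1, …, n, and let r_1, …, r_n be positive integers. Then there exists a ∈ L with a − a_i ∈ 𝔪_{w_i}^{r_i} for all i = 1, …, n. -/
open Polynomial in
/-- A nonzero polynomial over a valued field has a scalar multiple with coefficients in the
valuation ring, some coefficient equal to `1`, and all later coefficients nonunits. -/
lemma ValuationSubring.exists_mul_coeff_eq_one {K : Type*} [Field K] (v : ValuationSubring K)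
    {p : K[X]} (hp : p ≠ 0) :
    ∃ (c : K) (j : ℕ), c * p.coeff j = 1 ∧ (∀ k, c * p.coeff k ∈ v) ∧
      ∀ k, j < k → c * p.coeff k ∈ v.nonunits := by
  obtain ⟨j, hj, hmax⟩ := p.support.exists_max_image
    (fun k ↦ toLex (v.valuation (p.coeff k), k)) (support_nonempty.mpr hp)
  have hj0 : p.coeff j ≠ 0 := mem_support_iff.mp hj
  have hv0 : 0 < v.valuation (p.coeff j) := zero_lt_iff.mpr (v.valuation.ne_zero_iff.mpr hj0)
  refine ⟨(p.coeff j)⁻¹, j, inv_mul_cancel₀ hj0, fun k ↦ ?_, fun k hk ↦ ?_⟩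
  · by_cases hk0 : p.coeff k = 0
    · simp [hk0]
    have := hmax k (mem_support_iff.mpr hk0)
    rw [Prod.Lex.toLex_le_toLex] at this
    rw [← v.valuation_le_one_iff, map_mul, map_inv₀, inv_mul_le_one₀ hv0]
    rcases this with h | h
    · exact h.le
    · exact h.1.le
  · by_cases hk0 : p.coeff k = 0
    · simp [hk0]
    have := hmax k (mem_support_iff.mpr hk0)
    rw [Prod.Lex.toLex_le_toLex] at this
    rw [v.mem_nonunits_iff, map_mul, map_inv₀, inv_mul_lt_one₀ hv0]
    rcases this with h | h
    · exact h
    · exact absurd h.2 (by simpa using hk)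

section Algebraic

variable {K L : Type*} [Field K] [Field L] [Algebra K L] {v : ValuationSubring K}
  {w : ValuationSubring L}

lemma ValuationSubring.algebraMap_mem_nonunits_iff
    (hw : w.comap (algebraMap K L) = v) {x : K} :
    algebraMap K L x ∈ w.nonunits ↔ x ∈ v.nonunits := by
  subst hw
  simp [mem_nonunits_iff_or, ValuationSubring.mem_comap]

lemma ValuationSubring.mem_of_isIntegral_of_comap_eq
    (hw : w.comap (algebraMap K L) = v) {x : L} (hx : IsIntegral v x) : x ∈ w := by
  subst hw
  let f : w.comap (algebraMap K L) →+* w :=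
    ((algebraMap K L).comp (ValuationSubring.subtype _)).codRestrict w.toSubring fun x ↦ x.2
  have h : IsIntegral w x := by
    obtain ⟨p, hp, hpx⟩ := hx
    refine ⟨p.map f, hp.map f, ?_⟩
    rw [Polynomial.eval₂_map]
    exact hpx
  obtain ⟨y, rfl⟩ := IsIntegrallyClosed.isIntegral_iff.mp h
  exact y.2

/-- An element lying in every valuation ring above `v` is integral over `v`. -/
lemma ValuationSubring.isIntegral_of_forall_mem {y : L}
    (h : ∀ B : ValuationSubring L, (∀ x ∈ v, algebraMap K L x ∈ B) → y ∈ B) :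
    IsIntegral v y := by
  by_contra hy
  have : IsIntegrallyClosedIn (integralClosure v L).toSubring L :=
    inferInstanceAs (IsIntegrallyClosedIn (integralClosure v L) L)
  obtain ⟨V, hV, hyV⟩ := Subring.exists_le_valuationSubring_of_isIntegrallyClosedIn
    (R := (integralClosure v L).toSubring) (x := y) hy
  exact hyV (h V fun x hx ↦ hV ((integralClosure v L).algebraMap_mem ⟨x, hx⟩))

/-- An algebraic element `a` is a quotient of two integral elements, the denominator being a unit
in every extension of `v` whose valuation ring contains `a`. -/
lemma ValuationSubring.exists_isIntegral_mul (v : ValuationSubring K) {a : L}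
    (ha : IsAlgebraic K a) :
    ∃ y : L, IsIntegral v y ∧ IsIntegral v (y * a) ∧
      ∀ w : ValuationSubring L, w.comap (algebraMap K L) = v → a ∈ w → y ∉ w.nonunits := by
  obtain ⟨p, hp, hpa⟩ := ha
  obtain ⟨c, j, hj, hc, hlt⟩ := v.exists_mul_coeff_eq_one hp
  set d : ℕ → L := fun k ↦ algebraMap K L (c * p.coeff k) with hd
  set N := p.natDegree + 1
  have hjN : j < N := by
    refine Nat.lt_succ_of_le (Polynomial.le_natDegree_of_ne_zero fun h ↦ ?_)
    simp [h] at hj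
  have hsum : ∑ k ∈ Finset.range N, d k * a ^ k = 0 := by
    rw [Polynomial.aeval_eq_sum_range] at hpa
    simp only [hd, map_mul, mul_assoc, ← Finset.mul_sum]
    simp only [Algebra.smul_def] at hpa
    rw [hpa, mul_zero]
  set y : L := ∑ k ∈ Finset.Ico j N, d k * a ^ (k - j) with hy
  have hyj : y * a ^ j = -∑ k ∈ Finset.range j, d k * a ^ k := by
    rw [eq_neg_iff_add_eq_zero, ← hsum, ← Finset.sum_range_add_sum_Ico _ hjN.le, add_comm, hy,
      Finset.sum_mul]
    congr 1
    refine Finset.sum_congr rfl fun k hk ↦ ?_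
    rw [mul_assoc, pow_sub_mul_pow _ (Finset.mem_Ico.mp hk).1]
  have hya : a ≠ 0 → y = -∑ k ∈ Finset.range j, d k * a⁻¹ ^ (j - k) := fun ha0 ↦ by
    refine mul_right_cancel₀ (pow_ne_zero j ha0) ?_
    rw [hyj, neg_mul, Finset.sum_mul]
    congr 1
    refine Finset.sum_congr rfl fun k hk ↦ ?_
    have hk := (Finset.mem_range.mp hk).le
    rw [mul_assoc, ← pow_sub_mul_pow a hk, ← mul_assoc (a⁻¹ ^ _), ← mul_pow, inv_mul_cancel₀ ha0,
      one_pow, one_mul]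
  have hyaa : a ≠ 0 → y * a = -∑ k ∈ Finset.range j, d k * a⁻¹ ^ (j - k - 1) := fun ha0 ↦ by
    rw [hya ha0, neg_mul, Finset.sum_mul]
    congr 1
    refine Finset.sum_congr rfl fun k hk ↦ ?_
    have hk := Finset.mem_range.mp hk
    obtain ⟨m, hm⟩ : ∃ m, j - k = m + 1 := ⟨j - k - 1, by omega⟩
    rw [hm, Nat.add_sub_cancel, pow_succ, mul_assoc, mul_assoc, inv_mul_cancel₀ ha0, mul_one]
  have hyB (B : ValuationSubring L) (haB : a ∈ B) (hB : ∀ x ∈ v, algebraMap K L x ∈ B) : y ∈ B :=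
    sum_mem fun k _ ↦ MulMemClass.mul_mem (hB _ (hc k)) (pow_mem haB _)
  have key (B : ValuationSubring L) (hB : ∀ x ∈ v, algebraMap K L x ∈ B) : y ∈ B ∧ y * a ∈ B := by
    by_cases haB : a ∈ B
    · exact ⟨hyB B haB hB, MulMemClass.mul_mem (hyB B haB hB) haB⟩
    have ha0 : a ≠ 0 := by rintro rfl; exact haB B.zero_mem
    have hinv := (B.mem_or_inv_mem a).resolve_left haB
    rw [hyaa ha0, hya ha0]
    exact ⟨NegMemClass.neg_mem (sum_mem fun k _ ↦ MulMemClass.mul_mem (hB _ (hc k)) (pow_mem hinv _)),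
      NegMemClass.neg_mem (sum_mem fun k _ ↦ MulMemClass.mul_mem (hB _ (hc k)) (pow_mem hinv _))⟩
  refine ⟨y, isIntegral_of_forall_mem fun B hB ↦ (key B hB).1,
    isIntegral_of_forall_mem fun B hB ↦ (key B hB).2, fun w hw haw hyw ↦ ?_⟩
  have htail : ∑ k ∈ Finset.Ico (j + 1) N, d k * a ^ (k - j) ∈ w.nonunits := by
    refine sum_mem fun k hk ↦ ?_
    have hdk := (algebraMap_mem_nonunits_iff hw).mpr (hlt k (Finset.mem_Ico.mp hk).1)
    rw [mem_nonunits_iff] at hdk ⊢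
    rw [map_mul]
    exact mul_lt_one_of_lt_of_le hdk ((w.valuation_le_one_iff _).mpr (pow_mem haw _))
  have hone : (1 : L) ∈ w.nonunits := by
    rw [hy, Finset.sum_eq_sum_Ico_succ_bot hjN] at hyw
    have hdj : d j = 1 := by rw [hd]; simp only [hj, map_one]
    simpa [hdj] using sub_mem hyw htail
  simp [mem_nonunits_iff] at hone

/-- The inclusion of the integral closure of `v` into an extension `w` of `v`. -/
def ValuationSubring.integralClosureInclusion (hw : w.comap (algebraMap K L) = v) :
    integralClosure v L →+* w :=
  ((integralClosure v L).val : _ →+* L).codRestrict w.toSubring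
    fun x ↦ mem_of_isIntegral_of_comap_eq hw ((mem_integralClosure_iff v L).mp x.2)

/-- The center of an extension `w` of `v` on the integral closure of `v`. -/
def ValuationSubring.center (hw : w.comap (algebraMap K L) = v) : Ideal (integralClosure v L) :=
  (IsLocalRing.maximalIdeal w).comap (integralClosureInclusion hw)

lemma ValuationSubring.mem_center_iff (hw : w.comap (algebraMap K L) = v)
    {x : integralClosure v L} : x ∈ center hw ↔ (x : L) ∈ w.nonunits :=
  coe_mem_nonunits_iff.symm

instance ValuationSubring.isMaximal_center (hw : w.comap (algebraMap K L) = v) :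
    (center hw).IsMaximal := by
  have : (center hw).IsPrime := Ideal.comap_isPrime _ _
  refine Ideal.isMaximal_of_isIntegral_of_isMaximal_comap (R := v) _ ?_
  convert IsLocalRing.maximalIdeal.isMaximal v
  ext x
  rw [Ideal.mem_comap, mem_center_iff, ← coe_mem_nonunits_iff]
  exact algebraMap_mem_nonunits_iff hw

variable [Algebra.IsAlgebraic K L]

lemma ValuationSubring.le_of_center_eq {w' : ValuationSubring L}
    (hw : w.comap (algebraMap K L) = v) (hw' : w'.comap (algebraMap K L) = v)
    (h : center hw = center hw') : w ≤ w' := by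
  intro a ha
  obtain ⟨y, hy, hya, hyw⟩ := v.exists_isIntegral_mul (Algebra.IsAlgebraic.isAlgebraic (R := K) a)
  have hyw' : y ∉ w'.nonunits := fun hmem ↦ by
    have : (⟨y, hy⟩ : integralClosure v L) ∈ center hw := h ▸ (mem_center_iff hw').mpr hmem
    exact hyw w hw ha ((mem_center_iff hw).mp this)
  rw [mem_nonunits_iff_or] at hyw'
  push Not at hyw'
  rw [← inv_mul_cancel_left₀ hyw'.1 a]
  exact mul_mem _ _ _ hyw'.2 (mem_of_isIntegral_of_comap_eq hw' hya)

/-- The integral closure of `v` is dense in every extension of `v` for the topology defined by the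
powers of the maximal ideal. -/
lemma ValuationSubring.exists_integralClosureInclusion_sub_mem_pow
    (hw : w.comap (algebraMap K L) = v) (a : w) (r : ℕ) :
    ∃ x, integralClosureInclusion hw x - a ∈ IsLocalRing.maximalIdeal w ^ r := by
  obtain ⟨y, hy, hya, hyw⟩ :=
    v.exists_isIntegral_mul (Algebra.IsAlgebraic.isAlgebraic (R := K) (a : L))
  have hyc : (⟨y, hy⟩ : integralClosure v L) ∉ center hw := fun h ↦
    hyw w hw a.2 ((mem_center_iff hw).mp h)
  have hcop : IsCoprime (Ideal.span {(⟨y, hy⟩ : integralClosure v L)}) (center hw ^ r) := by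
    refine IsCoprime.pow_right (Ideal.isCoprime_iff_sup_eq.mpr ?_)
    rw [sup_comm]
    exact (isMaximal_center hw).out.2 _ (left_lt_sup.mpr (by simpa using hyc))
  obtain ⟨_, hs, t, ht, hst⟩ := Ideal.isCoprime_iff_exists.mp hcop
  obtain ⟨z, rfl⟩ := Ideal.mem_span_singleton'.mp hs
  refine ⟨z * ⟨y * a, hya⟩, ?_⟩
  have hmul : integralClosureInclusion hw ⟨y * a, hya⟩ =
    integralClosureInclusion hw ⟨y, hy⟩ * a := rfl
  have ht' : integralClosureInclusion hw t ∈ IsLocalRing.maximalIdeal w ^ r :=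
    Ideal.le_comap_pow _ r ht
  have hst' := congrArg (integralClosureInclusion hw) hst
  rw [map_add, map_mul, map_one] at hst'
  rw [map_mul, hmul]
  convert NegMemClass.neg_mem (Ideal.mul_mem_left _ a ht') using 1
  linear_combination a * hst'

end Algebraic


/-- **Weak approximation.** Let `(K, v)` be a valued field and `L/K` an algebraic field
extension. Let `w₁, …, wₙ` be pairwise distinct extensions of `v` to `L`, let `aᵢ ∈ 𝒪_{wᵢ}`
and let `rᵢ ≥ 1` be integers. Then there is `b ∈ L` with `b - aᵢ ∈ 𝔪_{wᵢ}^{rᵢ}` for all `i`. -/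
theorem stmt_6 {K L : Type*} [Field K] [Field L] [Algebra K L] [Algebra.IsAlgebraic K L]
    (v : ValuationSubring K) (n : ℕ) (w : Fin n → ValuationSubring L)
    (hw : ∀ i, (w i).comap (algebraMap K L) = v) (hdist : Function.Injective w)
    (a : Fin n → L) (ha : ∀ i, a i ∈ w i) (r : Fin n → ℕ) (hr : ∀ i, 1 ≤ r i) :
    ∃ b : L, ∀ i, ∃ c : w i, (c : L) = b - a i ∧
      c ∈ (IsLocalRing.maximalIdeal (w i)) ^ (r i) := by
  have hcop : Pairwise (Function.onFun IsCoprime fun i ↦ ValuationSubring.center (hw i) ^ r i) :=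
    fun i j hij ↦ IsCoprime.pow <| Ideal.isCoprime_of_isMaximal fun h ↦ hij <| hdist <|
      le_antisymm (ValuationSubring.le_of_center_eq (hw i) (hw j) h)
        (ValuationSubring.le_of_center_eq (hw j) (hw i) h.symm)
  choose x hx using fun i ↦ ValuationSubring.exists_integralClosureInclusion_sub_mem_pow
    (hw i) ⟨a i, ha i⟩ (r i)
  obtain ⟨b, hb⟩ := Ideal.pi_quotient_surjective hcop fun i ↦ Ideal.Quotient.mk _ (x i)
  refine ⟨b, fun i ↦ ⟨ValuationSubring.integralClosureInclusion (hw i) b - ⟨a i, ha i⟩, rfl, ?_⟩⟩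
  have hbx := Ideal.le_comap_pow (ValuationSubring.integralClosureInclusion (hw i)) (r i)
    (Ideal.Quotient.eq.mp (hb i))
  rw [Ideal.mem_comap, map_sub] at hbx
  simpa using add_mem hbx (hx i)
end

section
/- Let (K, v) be a valued field and let M/K be a normal algebraic field extension. Then the group Aut_K(M) acts transitively on the set of valuation subrings of M extending 𝒪_v: for any two valuation subrings 𝒪, 𝒪' of M with 𝒪 ∩ K = 𝒪' ∩ K = 𝒪_v there exists g ∈ Aut_K(M) with g(𝒪') = 𝒪. -/
open Polynomial

namespace ValuationSubring

variable {K M : Type*} [Field K] [Field M] [Algebra K M]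

/-- The intersection of all valuation subrings of `M` containing the image of `v`,
i.e. the integral closure of `v` in `M`. -/
def integralHull (v : ValuationSubring K) (M : Type*) [Field M] [Algebra K M] : Subring M :=
  ⨅ W : {W : ValuationSubring M // v ≤ W.comap (algebraMap K M)}, W.1.toSubring

theorem mem_integralHull {v : ValuationSubring K} {x : M} :
    x ∈ v.integralHull M ↔
      ∀ W : ValuationSubring M, v ≤ W.comap (algebraMap K M) → x ∈ W := by
  simp only [integralHull, Subring.mem_iInf, Subtype.forall, mem_toSubring]

theorem integralHull_le {v : ValuationSubring K} {W : ValuationSubring M}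
    (hW : W.comap (algebraMap K M) = v) : v.integralHull M ≤ W.toSubring :=
  fun _ hx ↦ mem_integralHull.1 hx W hW.ge

theorem algebraMap_mem_integralHull {v : ValuationSubring K} {a : K} (ha : a ∈ v) :
    algebraMap K M a ∈ v.integralHull M :=
  mem_integralHull.2 fun _ hW ↦ hW ha

theorem map_mem_integralHull {v : ValuationSubring K} (g : M →ₐ[K] M) {x : M}
    (hx : x ∈ v.integralHull M) : g x ∈ v.integralHull M := by
  refine mem_integralHull.2 fun W hW ↦ mem_integralHull.1 hx (W.comap (g : M →+* M)) fun a ha ↦ ?_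
  simpa [mem_comap] using hW ha

theorem algebraMap_mem_nonunits_iff_s7 {v : ValuationSubring K} {W : ValuationSubring M}
    (hW : W.comap (algebraMap K M) = v) {a : K} :
    algebraMap K M a ∈ W.nonunits ↔ a ∈ v.nonunits := by
  simp only [mem_nonunits_iff_or, ← hW, mem_comap, map_inv₀, map_eq_zero]

theorem pow_mem_iff (O : ValuationSubring M) {x : M} {n : ℕ} (hn : n ≠ 0) :
    x ^ n ∈ O ↔ x ∈ O := by
  rw [← valuation_le_one_iff, ← valuation_le_one_iff, map_pow, pow_le_one_iff hn]

/-- Some coefficient of a nonzero polynomial strictly dominates all higher ones and weakly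
dominates all lower ones. -/
theorem exists_dominant_coeff (v : ValuationSubring K) {p : K[X]} (hp : p ≠ 0) :
    ∃ j, p.coeff j ≠ 0 ∧ (∀ i, p.coeff i / p.coeff j ∈ v) ∧
      ∀ i, j < i → p.coeff i / p.coeff j ∈ v.nonunits := by
  obtain ⟨j, hj, hmax⟩ := p.support.exists_max_image
    (fun i ↦ toLex (v.valuation (p.coeff i), i)) (by simpa using hp)
  have hj0 : p.coeff j ≠ 0 := by simpa using hj
  have hv : 0 < v.valuation (p.coeff j) := by simpa [zero_lt_iff] using hj0
  refine ⟨j, hj0, fun i ↦ ?_, fun i hi ↦ ?_⟩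
  · rw [← valuation_le_one_iff, map_div₀, div_le_one₀ hv]
    by_cases h0 : p.coeff i = 0
    · simp [h0]
    · rcases Prod.Lex.toLex_le_toLex.1 (hmax i (by simpa using h0)) with h | h
      exacts [h.le, h.1.le]
  · rw [mem_nonunits_iff, map_div₀, div_lt_one₀ hv]
    by_cases h0 : p.coeff i = 0
    · simpa [h0, zero_lt_iff] using hj0
    · rcases Prod.Lex.toLex_le_toLex.1 (hmax i (by simpa using h0)) with h | h
      exacts [h, absurd h.2 (by simpa using hi)]

/-- An extension of `v` is a localization of the integral hull of `v`. -/
theorem exists_mul_mem_integralHull [Algebra.IsAlgebraic K M] {v : ValuationSubring K}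
    {O : ValuationSubring M} (hO : O.comap (algebraMap K M) = v) {x : M} (hx : x ∈ O) :
    ∃ b ∈ v.integralHull M, b * x ∈ v.integralHull M ∧ b ∉ O.nonunits := by
  rcases eq_or_ne x 0 with rfl | hx0
  · exact ⟨1, Subring.one_mem _, by simp, by simp [mem_nonunits_iff]⟩
  obtain ⟨p, hp, hpx⟩ := Algebra.IsAlgebraic.isAlgebraic (R := K) x
  obtain ⟨j, hj, hle, hlt⟩ := v.exists_dominant_coeff hp
  set a : ℕ → M := fun i ↦ algebraMap K M (p.coeff i / p.coeff j) with ha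
  have haj : a j = 1 := by simp [ha, hj]
  have haW {W : ValuationSubring M} (hW : v ≤ W.comap (algebraMap K M)) (i : ℕ) : a i ∈ W :=
    hW (hle i)
  set b : M := ∑ i ∈ p.support with j ≤ i, a i * x ^ (i - j) with hb
  set d : M := ∑ i ∈ p.support with ¬ j ≤ i, a i * x⁻¹ ^ (j - i - 1) with hd
  have hbd : b * x = -d := by
    rw [eq_neg_iff_add_eq_zero]
    have key : (b * x + d) * (algebraMap K M (p.coeff j) * x ^ j) = aeval x p * x := by
      rw [aeval_eq_sum_range, ← p.sum_over_range' (f := fun i c ↦ c • x ^ i) (by simp) _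
        (Nat.lt_succ_self _), Polynomial.sum_def, ← Finset.sum_filter_add_sum_filter_not _ (j ≤ ·),
        add_mul, add_mul, hb, hd]
      simp only [Finset.sum_mul]
      have hj' : algebraMap K M (p.coeff j) ≠ 0 := by simpa using hj
      congr 1 <;> refine Finset.sum_congr rfl fun i hi ↦ ?_ <;>
        have hi := (Finset.mem_filter.1 hi).2
      · obtain ⟨k, rfl⟩ := Nat.exists_eq_add_of_le hi
        simp only [ha, map_div₀, Algebra.smul_def, Nat.add_sub_cancel_left, pow_add]
        field_simp
      · obtain ⟨k, rfl⟩ := Nat.exists_eq_add_of_lt (not_le.1 hi)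
        have : i + k + 1 - i - 1 = k := by omega
        simp only [ha, map_div₀, Algebra.smul_def, this, pow_add, inv_pow]
        field_simp
    rw [hpx, zero_mul] at key
    exact (mul_eq_zero.1 key).resolve_right (mul_ne_zero (by simpa using hj) (pow_ne_zero _ hx0))
  have hbW {W : ValuationSubring M} (hW : v ≤ W.comap (algebraMap K M)) (hxW : x ∈ W) : b ∈ W :=
    sum_mem fun i _ ↦ W.mul_mem _ _ (haW hW i) (pow_mem hxW _)
  have hdW {W : ValuationSubring M} (hW : v ≤ W.comap (algebraMap K M)) (hxW : x⁻¹ ∈ W) : d ∈ W :=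
    sum_mem fun i _ ↦ W.mul_mem _ _ (haW hW i) (pow_mem hxW _)
  refine ⟨b, mem_integralHull.2 fun W hW ↦ ?_, mem_integralHull.2 fun W hW ↦ ?_, ?_⟩
  · rcases W.mem_or_inv_mem x with h | h
    · exact hbW hW h
    · rw [(eq_mul_inv_iff_mul_eq₀ hx0).2 hbd]
      exact W.mul_mem _ _ (W.neg_mem _ (hdW hW h)) h
  · rcases W.mem_or_inv_mem x with h | h
    · exact W.mul_mem _ _ (hbW hW h) h
    · exact hbd ▸ W.neg_mem _ (hdW hW h)
  · have hjS : j ∈ p.support.filter (j ≤ ·) := by simpa using hj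
    have h1 : b - 1 ∈ O.nonunits := by
      rw [hb, ← Finset.add_sum_erase _ _ hjS, haj, Nat.sub_self, pow_zero, mul_one,
        add_sub_cancel_left]
      refine sum_mem fun i hi ↦ ?_
      simp only [Finset.mem_erase, Finset.mem_filter] at hi
      have hi' := hlt i (lt_of_le_of_ne hi.2.2 hi.1.symm)
      have hai : a i ∈ O.nonunits := (algebraMap_mem_nonunits_iff_s7 hO).2 hi'
      rw [mem_nonunits_iff] at hai ⊢
      rw [map_mul]
      exact mul_lt_one_of_lt_of_le hai ((O.valuation_le_one_iff _).2 (pow_mem hx _))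
    intro hbO
    have := sub_mem hbO h1
    simp [mem_nonunits_iff] at this

theorem map_mem_of_nonunits [Algebra.IsAlgebraic K M] {v : ValuationSubring K}
    {O O' : ValuationSubring M} (hO : O.comap (algebraMap K M) = v)
    (hO' : O'.comap (algebraMap K M) = v) (g : M →ₐ[K] M)
    (hg : ∀ b ∈ v.integralHull M, g b ∈ O.nonunits → b ∈ O'.nonunits) {x : M} (hx : x ∈ O') :
    g x ∈ O := by
  obtain ⟨b, hb, hbx, hbn⟩ := exists_mul_mem_integralHull hO' hx
  have hgb : g b ∉ O.nonunits := fun h ↦ hbn (hg b hb h)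
  rw [mem_nonunits_iff_or, not_or, not_not] at hgb
  have : g x = g (b * x) * (g b)⁻¹ := by
    rw [map_mul]
    field_simp [hgb.1]
  rw [this]
  exact O.mul_mem _ _ (integralHull_le hO (map_mem_integralHull g hbx)) hgb.2

theorem exists_algEquiv_of_isGalois [IsGalois K M] {v : ValuationSubring K}
    {O O' : ValuationSubring M} (hO : O.comap (algebraMap K M) = v)
    (hO' : O'.comap (algebraMap K M) = v) :
    ∃ g : Gal(M/K), ∀ x : M, x ∈ O' ↔ g x ∈ O := by
  let B := v.integralHull M
  have : IsInvariantSubring Gal(M/K) B := ⟨fun g _ hx ↦ map_mem_integralHull (g : M →ₐ[K] M) hx⟩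
  let _ : Algebra v B := RingHom.toAlgebra
    (((algebraMap K M).comp v.subtype).codRestrict B fun a ↦ algebraMap_mem_integralHull a.2)
  have : SMulCommClass Gal(M/K) v B := ⟨fun g a b ↦ Subtype.ext <| by
    simp only [Algebra.smul_def, smul_mul']
    exact congrArg (· * g • (b : M)) (g.commutes a)⟩
  have : Algebra.IsInvariant v B Gal(M/K) := ⟨fun b hb ↦ by
    obtain ⟨k, hk⟩ := (InfiniteGalois.mem_range_algebraMap_iff_fixed (k := K) (b : M)).2
      fun g ↦ congrArg Subtype.val (hb g)
    refine ⟨⟨k, ?_⟩, Subtype.ext hk⟩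
    rw [← hO, mem_comap, hk]
    exact integralHull_le hO b.2⟩
  let _ : TopologicalSpace B := ⊥
  have : DiscreteTopology B := ⟨rfl⟩
  have : ContinuousSMul Gal(M/K) B := continuousSMul_iff_stabilizer_isOpen.2 fun b ↦ by
    convert stabilizer_isOpen_of_isIntegral (K := K) (b : M) using 1
    ext g
    exact Subtype.ext_iff
  let center (W : ValuationSubring M) (hW : W.comap (algebraMap K M) = v) : Ideal B :=
    (IsLocalRing.maximalIdeal W).comap (Subring.inclusion (integralHull_le hW) : B →+* W)
  have mem_center {W : ValuationSubring M} (hW : W.comap (algebraMap K M) = v) (b : B) :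
      b ∈ center W hW ↔ (b : M) ∈ W.nonunits := coe_mem_nonunits_iff.symm
  have under_center {W : ValuationSubring M} (hW : W.comap (algebraMap K M) = v) (a : v) :
      a ∈ (center W hW).under v ↔ (a : K) ∈ v.nonunits := by
    rw [Ideal.under_def, Ideal.mem_comap, mem_center hW]
    exact algebraMap_mem_nonunits_iff_s7 hW
  have : (center O hO).IsPrime := Ideal.comap_isPrime _ _
  have : (center O' hO').IsPrime := Ideal.comap_isPrime _ _
  obtain ⟨g, hg⟩ := Algebra.IsInvariant.exists_smul_of_under_eq_of_profinite (A := v)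
    (G := Gal(M/K)) (center O' hO') (center O hO) (by ext a; rw [under_center hO, under_center hO'])
  have key (b : B) : g (b : M) ∈ O.nonunits ↔ (b : M) ∈ O'.nonunits := by
    rw [← mem_center hO' b, ← Ideal.smul_mem_pointwise_smul_iff (a := g), ← hg, mem_center hO]
    rfl
  refine ⟨g, fun x ↦ ⟨map_mem_of_nonunits hO hO' (g : M →ₐ[K] M) fun b hb ↦ (key ⟨b, hb⟩).1,
    fun hx ↦ ?_⟩⟩
  have := map_mem_of_nonunits hO' hO (g.symm : M →ₐ[K] M) (fun b hb h ↦ ?_) hx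
  · simpa using this
  · simpa using (key ⟨g.symm b, map_mem_integralHull (g.symm : M →ₐ[K] M) hb⟩).2 h

end ValuationSubring

/-- Let `(K, v)` be a valued field and `M/K` a normal algebraic field extension. Then
`Aut_K(M)` acts transitively on the valuation subrings of `M` extending `𝒪_v`: for any two
such `𝒪, 𝒪'` there is `g ∈ Aut_K(M)` with `g(𝒪') = 𝒪`. -/
theorem stmt_7 {K M : Type*} [Field K] [Field M] [Algebra K M] [Normal K M]
    (v : ValuationSubring K) (𝒪 𝒪' : ValuationSubring M)
    (h : 𝒪.comap (algebraMap K M) = v) (h' : 𝒪'.comap (algebraMap K M) = v) :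
    ∃ g : M ≃ₐ[K] M, ∀ x : M, x ∈ 𝒪' ↔ g x ∈ 𝒪 := by
  let S := separableClosure K M
  obtain ⟨g, hg⟩ := ValuationSubring.exists_algEquiv_of_isGalois (K := K) (M := S) (v := v)
    (O := 𝒪.comap (algebraMap S M)) (O' := 𝒪'.comap (algebraMap S M))
    (by rw [ValuationSubring.comap_comap, ← IsScalarTower.algebraMap_eq, h])
    (by rw [ValuationSubring.comap_comap, ← IsScalarTower.algebraMap_eq, h'])
  refine ⟨g.liftNormal M, fun x ↦ ?_⟩
  obtain ⟨n, y, hy⟩ := IsPurelyInseparable.pow_mem S (ringExpChar S) x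
  have hn : ringExpChar S ^ n ≠ 0 := pow_ne_zero _ (expChar_pos S _).ne'
  rw [← 𝒪'.pow_mem_iff hn, ← 𝒪.pow_mem_iff hn, ← map_pow, ← hy, AlgEquiv.liftNormal_commutes]
  exact hg y
end

section
/- Let K be a field and let n ≥ 1 be an integer coprime with the characteristic of K (i.e. n is invertible in K). Let w be the number of n-th roots of unity contained in K, let a ∈ K, and let L be the splitting field of X^n − a over K. Then L/K is an abelian Galois extension if and only if a^w ∈ K^n = {b^n : b ∈ K}. -/
/-- If `x ^ s = x` in a group, then the order of `x` divides `s - 1`. -/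
lemma orderOf_dvd_sub_one_of_pow_eq_self {G : Type*} [Group G] {x : G} {s : ℕ} (hs : 1 ≤ s)
    (h : x ^ s = x) : orderOf x ∣ s - 1 := by
  apply orderOf_dvd_of_pow_eq_one
  apply mul_right_cancel (b := x)
  rw [← pow_succ, Nat.sub_add_cancel hs, h, one_mul]

/-- The `n`-th roots of unity of a field `K`, `w` in number, are generated by a primitive `w`-th
root of unity. -/
lemma exists_isPrimitiveRoot_natCard_pow_eq_one (K : Type*) [Field K] (n : ℕ) [NeZero n] :
    Nat.card {ζ : K // ζ ^ n = 1} ≠ 0 ∧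
    (∃ g : K, IsPrimitiveRoot g (Nat.card {ζ : K // ζ ^ n = 1}) ∧ g ^ n = 1) ∧
    ∀ c : K, c ^ n = 1 → c ^ Nat.card {ζ : K // ζ ^ n = 1} = 1 := by
  have e : Nat.card {ζ : K // ζ ^ n = 1} = Nat.card (rootsOfUnity n K) :=
    Nat.card_congr
      { toFun := fun z => ⟨Units.ofPowEqOne z.1 n z.2 (NeZero.ne n), by
          rw [mem_rootsOfUnity, Units.pow_ofPowEqOne]⟩
        invFun := fun z => ⟨(z.1 : K), (mem_rootsOfUnity' n z.1).1 z.2⟩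
        left_inv := fun z => by simp
        right_inv := fun z => by
          apply Subtype.ext
          apply Units.ext
          simp }
  rw [e]
  refine ⟨Nat.card_pos.ne', ?_, fun c hc => ?_⟩
  · obtain ⟨g, hg⟩ := IsCyclic.exists_ofOrder_eq_natCard (α := rootsOfUnity n K)
    refine ⟨((g : Kˣ) : K), ?_, (mem_rootsOfUnity' n g.1).1 g.2⟩
    rw [IsPrimitiveRoot.coe_units_iff, ← hg, ← Subgroup.orderOf_coe]
    exact IsPrimitiveRoot.orderOf _
  · have h := pow_card_eq_one' (x := rootsOfUnity.mkOfPowEq c hc)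
    have h2 := congrArg (fun z : rootsOfUnity n K => ((z : Kˣ) : K)) h
    simpa using h2

open Polynomial in
/-- A field over which `X ^ n - 1` splits contains a primitive `n`-th root of unity, if `n` is
invertible in it. -/
lemma exists_isPrimitiveRoot_of_splits_X_pow_sub_one {L : Type*} [Field L] {n : ℕ}
    (hn : (n : L) ≠ 0) (h : (X ^ n - 1 : L[X]).Splits) : ∃ ζ : L, IsPrimitiveRoot ζ n := by
  have : NeZero (n : L) := ⟨hn⟩
  have hn0 : 0 < n := Nat.pos_of_ne_zero (by rintro rfl; simp at hn)
  have hs : (cyclotomic n L).Splits :=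
    h.of_dvd (X_pow_sub_C_ne_zero hn0 1) (cyclotomic.dvd_X_pow_sub_one n L)
  obtain ⟨ζ, hζ⟩ := hs.exists_eval_eq_zero (degree_cyclotomic_pos n L hn0).ne'
  exact ⟨ζ, isRoot_cyclotomic_iff.1 hζ⟩

/-- For `α ≠ 0` with `α ^ n = a ∈ K`, if `σ ζ = ζ ^ s` and `σ` commutes with every
automorphism, then `a ^ s` and `a` agree up to an `n`-th power in `K`. -/
lemma exists_pow_eq_mul_pow_of_commute {K L : Type*} [Field K] [Field L] [Algebra K L]
    [FiniteDimensional K L] [IsGalois K L] {n : ℕ} [NeZero n] {a : K} {ζ α : L}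
    (hζ : IsPrimitiveRoot ζ n) (hα : α ^ n = algebraMap K L a) (hα0 : α ≠ 0)
    (σ : L ≃ₐ[K] L) (hσ : ∀ τ : L ≃ₐ[K] L, σ * τ = τ * σ) {s : ℕ} (hs : σ ζ = ζ ^ s) :
    ∃ c : K, a ^ s = a * c ^ n := by
  have key : α ^ s / σ α ∈ (⊥ : IntermediateField K L) := by
    rw [IsGalois.mem_bot_iff_fixed]
    intro τ
    have hτn : (τ α / α) ^ n = 1 := by
      rw [div_pow, ← map_pow, hα, AlgEquiv.commutes, div_self]
      rw [← hα]; exact pow_ne_zero _ hα0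
    obtain ⟨t, -, ht⟩ := hζ.eq_pow_of_pow_eq_one hτn
    have hτ : τ α = ζ ^ t * α := by rw [ht, div_mul_cancel₀ _ hα0]
    have hc : τ (σ α) = (ζ ^ s) ^ t * σ α := by
      rw [← AlgEquiv.mul_apply, ← hσ, AlgEquiv.mul_apply, hτ, map_mul, map_pow, hs]
    have hζ0 : ζ ≠ 0 := hζ.ne_zero (NeZero.ne n)
    have hσ0 : σ α ≠ 0 := by simpa using hα0
    rw [map_div₀, map_pow, hτ, hc, mul_pow, ← pow_mul, ← pow_mul, mul_comm t s]
    exact mul_div_mul_left _ _ (pow_ne_zero _ hζ0)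
  obtain ⟨c, hc⟩ := IntermediateField.mem_bot.1 key
  refine ⟨c, (algebraMap K L).injective ?_⟩
  have hσ0 : σ α ≠ 0 := by simpa using hα0
  rw [map_mul, map_pow, map_pow, hc, div_pow, ← map_pow σ, hα, AlgEquiv.commutes, ← hα,
    mul_div_cancel₀ _ (pow_ne_zero _ hα0), ← pow_mul, ← pow_mul, mul_comm]

/-- If `α ^ w = b * ζ ^ k` with `b ∈ K`, and every automorphism acts on `ζ` through exponents
congruent to `1` modulo `w`, then automorphisms commute on `α`. -/
lemma apply_apply_comm_of_pow_eq {K L : Type*} [Field K] [Field L] [Algebra K L]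
    {w k : ℕ} {b : K} {ζ α : L} (hζ : ζ ≠ 0) (hα : α ≠ 0)
    (hw : α ^ w = algebraMap K L b * ζ ^ k) {σ τ : L ≃ₐ[K] L} {u v p q : ℕ}
    (hσ : σ ζ = ζ ^ (1 + w * u)) (hτ : τ ζ = ζ ^ (1 + w * v))
    (hσα : σ α = ζ ^ p * α) (hτα : τ α = ζ ^ q * α) : σ (τ α) = τ (σ α) := by
  have aux : ∀ (ρ : L ≃ₐ[K] L) (u p : ℕ), ρ ζ = ζ ^ (1 + w * u) → ρ α = ζ ^ p * α →
      ζ ^ (p * w) = ζ ^ (k * (w * u)) := by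
    intro ρ u p h1 h2
    have h := congrArg ρ hw
    rw [map_pow, map_mul, map_pow, AlgEquiv.commutes, h1, h2, mul_pow, hw] at h
    have hb : algebraMap K L b ≠ 0 := by
      intro hb
      rw [hb, zero_mul] at hw
      exact pow_ne_zero _ hα hw
    apply mul_right_cancel₀ (mul_ne_zero hb (pow_ne_zero k hζ))
    rw [pow_mul, h]
    ring
  have e1 := aux σ u p hσ hσα
  have e2 := aux τ v q hτ hτα
  have e : ζ ^ (w * u * q) = ζ ^ (w * v * p) := by
    calc ζ ^ (w * u * q) = (ζ ^ (q * w)) ^ u := by rw [← pow_mul]; ring_nf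
      _ = (ζ ^ (p * w)) ^ v := by rw [e2, e1, ← pow_mul, ← pow_mul]; ring_nf
      _ = ζ ^ (w * v * p) := by rw [← pow_mul]; ring_nf
  rw [hσα, hτα, map_mul, map_mul, map_pow, map_pow, hσ, hτ, hσα, hτα, ← pow_mul, ← pow_mul,
    add_mul, add_mul, pow_add, pow_add, e]
  ring

open Polynomial in
/-- Schinzel's theorem on abelian binomials, for an arbitrary splitting field `L` of `X ^ n - a`. -/
theorem isGalois_and_comm_iff_exists_pow_eq {K L : Type*} [Field K] [Field L] [Algebra K L]
    {n : ℕ} (hchar : (n : K) ≠ 0) (a : K) [IsSplittingField K L (X ^ n - C a : K[X])] :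
    (IsGalois K L ∧ ∀ σ τ : L ≃ₐ[K] L, σ * τ = τ * σ) ↔
    ∃ b : K, a ^ (Nat.card {ζ : K // ζ ^ n = 1}) = b ^ n := by
  have : NeZero n := ⟨by rintro rfl; simp at hchar⟩
  have hn : 1 ≤ n := NeZero.one_le
  obtain ⟨hw0, ⟨g, hg, hgn⟩, hwc⟩ := exists_isPrimitiveRoot_natCard_pow_eq_one K n
  set w := Nat.card {ζ : K // ζ ^ n = 1}
  have hsplit := IsSplittingField.splits L (X ^ n - C a : K[X])
  have : FiniteDimensional K L := IsSplittingField.finiteDimensional L (X ^ n - C a : K[X])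
  have hext : ∀ φ ψ : L ≃ₐ[K] L, (∀ x : L, x ^ n = algebraMap K L a → φ x = ψ x) → φ = ψ := by
    intro φ ψ h
    have : (φ : L →ₐ[K] L) = ψ := by
      refine AlgHom.ext_of_adjoin_eq_top
        (IsSplittingField.adjoin_rootSet L (X ^ n - C a : K[X])) fun x hx => ?_
      refine h x ?_
      have := (mem_rootSet.1 hx).2
      simpa [sub_eq_zero] using this
    exact AlgEquiv.ext fun x => DFunLike.congr_fun this x
  rcases eq_or_ne a 0 with rfl | ha
  · refine iff_of_true ⟨?_, fun σ τ => hext _ _ fun x hx => ?_⟩ ⟨0, ?_⟩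
    · have : IsSplittingField K L (X : K[X]) := by
        refine ⟨by simp, ?_⟩
        rw [eq_top_iff, ← IsSplittingField.adjoin_rootSet L (X ^ n - C 0 : K[X])]
        refine Algebra.adjoin_mono fun x hx => ?_
        have := (mem_rootSet.1 hx).2
        rw [mem_rootSet]
        simpa [NeZero.ne n] using this
      exact IsGalois.of_separable_splitting_field (p := (X : K[X])) separable_X
    · have : x = 0 := by simpa [NeZero.ne n] using hx
      simp [this]
    · rw [zero_pow hw0, zero_pow (NeZero.ne n)]
  have hgal : IsGalois K L := IsGalois.of_separable_splitting_field
    (separable_X_pow_sub_C a hchar ha)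
  have hcharL : (n : L) ≠ 0 := by
    rw [← map_natCast (algebraMap K L)]
    exact (map_ne_zero (algebraMap K L)).2 hchar
  obtain ⟨ζ, hζ⟩ := exists_isPrimitiveRoot_of_splits_X_pow_sub_one hcharL
    (by simpa using splits_X_pow_sub_one_of_X_pow_sub_C (algebraMap K L) n ha hsplit)
  have hζ0 : ζ ≠ 0 := hζ.ne_zero (NeZero.ne n)
  obtain ⟨α, hα'⟩ := hsplit.exists_eval_eq_zero (by
    rw [degree_map, degree_X_pow_sub_C (by omega)]
    exact_mod_cast NeZero.ne n)
  have hα : α ^ n = algebraMap K L a := by simpa [sub_eq_zero] using hα'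
  have hα0 : α ≠ 0 := by
    rintro rfl
    rw [zero_pow (NeZero.ne n)] at hα
    exact ha (by simpa using hα.symm)
  have hroot : ∀ x : L, x ^ n = algebraMap K L a → ∃ i : ℕ, x = ζ ^ i * α := by
    intro x hx
    have : (x / α) ^ n = 1 := by
      rw [div_pow, hx, hα, div_self]
      rw [← hα]; exact pow_ne_zero _ hα0
    obtain ⟨i, -, hi⟩ := hζ.eq_pow_of_pow_eq_one this
    exact ⟨i, by rw [hi, div_mul_cancel₀ _ hα0]⟩
  have hσζ : ∀ σ : L ≃ₐ[K] L, ∃ s : ℕ, 1 ≤ s ∧ σ ζ = ζ ^ s := by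
    intro σ
    obtain ⟨s, -, hs⟩ := hζ.eq_pow_of_pow_eq_one (ξ := σ ζ) (by
      rw [← map_pow, hζ.pow_eq_one, map_one])
    exact ⟨s + n, by omega, by rw [pow_add, hζ.pow_eq_one, mul_one, hs]⟩
  constructor
  · rintro ⟨-, hcomm⟩
    set H := (powMonoidHom n : Kˣ →* Kˣ).range
    let q : Kˣ ⧸ H := QuotientGroup.mk (Units.mk0 a ha)
    have hqn : q ^ n = 1 := by
      rw [← QuotientGroup.mk_pow, QuotientGroup.eq_one_iff]
      exact ⟨_, rfl⟩
    obtain ⟨m, hm⟩ : orderOf q ∣ n := orderOf_dvd_of_pow_eq_one hqn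
    have hprim : IsPrimitiveRoot (ζ ^ m) (orderOf q) :=
      hζ.pow (by omega) (by rw [hm, mul_comm])
    have hfix : ζ ^ m ∈ (⊥ : IntermediateField K L) := by
      rw [IsGalois.mem_bot_iff_fixed]
      intro σ
      obtain ⟨s, hs1, hs⟩ := hσζ σ
      obtain ⟨c, hc⟩ := exists_pow_eq_mul_pow_of_commute hζ hα hα0 σ (hcomm σ) hs
      have hc0 : c ≠ 0 := by
        rintro rfl
        rw [zero_pow (NeZero.ne n), mul_zero] at hc
        exact pow_ne_zero _ ha hc
      have hqs : q ^ s = q := by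
        rw [← QuotientGroup.mk_pow, eq_comm, QuotientGroup.eq]
        refine ⟨Units.mk0 c hc0, ?_⟩
        rw [eq_inv_mul_iff_mul_eq]
        apply Units.ext
        simp [hc]
      have hd : orderOf q ∣ s - 1 := orderOf_dvd_sub_one_of_pow_eq_self hs1 hqs
      have hs' : (ζ ^ m) ^ (s - 1) = 1 := (hprim.pow_eq_one_iff_dvd _).2 hd
      rw [map_pow, hs, ← pow_mul, mul_comm, pow_mul, ← Nat.sub_add_cancel hs1, pow_succ, hs',
        one_mul]
    obtain ⟨c, hc⟩ := IntermediateField.mem_bot.1 hfix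
    have hcw : c ^ w = 1 := hwc c <| (algebraMap K L).injective <| by
      rw [map_pow, hc, ← pow_mul, mul_comm, pow_mul, hζ.pow_eq_one, one_pow, map_one]
    have hdvd : orderOf q ∣ w := hprim.dvd_of_pow_eq_one _ <| by
      rw [← hc, ← map_pow, hcw, map_one]
    have hqw : q ^ w = 1 := orderOf_dvd_iff_pow_eq_one.1 hdvd
    rw [← QuotientGroup.mk_pow, QuotientGroup.eq_one_iff] at hqw
    obtain ⟨b, hb⟩ := hqw
    exact ⟨b, by simpa using (congrArg Units.val hb).symm⟩
  · rintro ⟨b, hb⟩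
    refine ⟨hgal, ?_⟩
    obtain ⟨m, hm⟩ : w ∣ n := hg.dvd_of_pow_eq_one n hgn
    have : NeZero w := ⟨hw0⟩
    have hprim : IsPrimitiveRoot (ζ ^ m) w := hζ.pow (by omega) (by rw [hm, mul_comm])
    have hexp : ∀ σ : L ≃ₐ[K] L, ∃ u : ℕ, σ ζ = ζ ^ (1 + w * u) := by
      intro σ
      obtain ⟨s, hs1, hs⟩ := hσζ σ
      obtain ⟨i, -, hi⟩ := (hg.map_of_injective
        (algebraMap K L).injective).eq_pow_of_pow_eq_one hprim.pow_eq_one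
      have hfix : σ (ζ ^ m) = ζ ^ m := by
        rw [← hi, ← map_pow, AlgEquiv.commutes]
      rw [map_pow, hs, ← pow_mul, mul_comm, pow_mul] at hfix
      have hd : w ∣ s - 1 := hprim.dvd_of_pow_eq_one _ <| by
        apply mul_right_cancel₀ (pow_ne_zero m hζ0)
        rw [← pow_succ, Nat.sub_add_cancel hs1, hfix, one_mul]
      obtain ⟨u, hu⟩ := hd
      exact ⟨u, by rw [hs, ← hu]; congr 1; omega⟩
    have hb0 : algebraMap K L b ≠ 0 := by
      intro h0
      have : b = 0 := by simpa using h0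
      rw [this, zero_pow (NeZero.ne n)] at hb
      exact pow_ne_zero _ ha hb
    obtain ⟨k, -, hk⟩ := hζ.eq_pow_of_pow_eq_one (ξ := α ^ w / algebraMap K L b) (by
      rw [div_pow, ← pow_mul, mul_comm, pow_mul, hα, ← map_pow, hb, map_pow,
        div_self (pow_ne_zero _ hb0)])
    have hαw : α ^ w = algebraMap K L b * ζ ^ k := by rw [hk, mul_div_cancel₀ _ hb0]
    have hσα : ∀ σ : L ≃ₐ[K] L, ∃ p : ℕ, σ α = ζ ^ p * α := fun σ =>
      hroot _ (by rw [← map_pow, hα, AlgEquiv.commutes])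
    intro σ τ
    obtain ⟨u, hu⟩ := hexp σ
    obtain ⟨v, hv⟩ := hexp τ
    obtain ⟨p, hp⟩ := hσα σ
    obtain ⟨q, hq⟩ := hσα τ
    refine hext _ _ fun x hx => ?_
    obtain ⟨i, rfl⟩ := hroot x hx
    have hζc : σ (τ ζ) = τ (σ ζ) := by
      rw [hu, hv, map_pow, map_pow, hu, hv, ← pow_mul, ← pow_mul, mul_comm]
    rw [AlgEquiv.mul_apply, AlgEquiv.mul_apply, map_mul, map_mul, map_mul, map_mul, map_pow,
      map_pow, map_pow, map_pow, hζc, apply_apply_comm_of_pow_eq hζ0 hα0 hαw hu hv hp hq]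

open Polynomial in
/-- Let `K` be a field and `n ≥ 1` an integer coprime with the characteristic of `K`
(i.e. `(n : K) ≠ 0`). Let `w` be the number of `n`-th roots of unity in `K`, let `a ∈ K`,
and let `L` be the splitting field of `X^n - a` over `K`. Then `L/K` is an abelian Galois
extension if and only if `a^w ∈ K^n`. -/
theorem stmt_16 {K : Type*} [Field K] (n : ℕ) (hn : 1 ≤ n) (hchar : (n : K) ≠ 0) (a : K) :
    (IsGalois K ((X ^ n - C a : K[X]).SplittingField) ∧
      ∀ σ τ : (X ^ n - C a : K[X]).SplittingField ≃ₐ[K] (X ^ n - C a : K[X]).SplittingField,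
        σ * τ = τ * σ) ↔
    ∃ b : K, a ^ (Nat.card {ζ : K // ζ ^ n = 1}) = b ^ n := by
  exact isGalois_and_comm_iff_exists_pow_eq hchar a
end

section
/- Let k be a field and let A be a localization at a multiplicative subset of a finitely generated k-algebra that is an integral domain. Let K be the fraction field of A and let L/K be a finite field extension. Then the integral closure of A in L is a finitely generated A-module. -/
open scoped nonZeroDivisors

theorem restrictScalars_integralClosure (R S L : Type*) [CommRing R] [CommRing S] [CommRing L]
    [Algebra R S] [Algebra R L] [Algebra S L] [IsScalarTower R S L] [Algebra.IsIntegral R S] :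
    (integralClosure S L).restrictScalars R = integralClosure R L :=
  Subalgebra.ext fun x ↦ ⟨isIntegral_trans x, IsIntegral.tower_top⟩

theorem finite_integralClosure_tower_bot (R S L : Type*) [CommRing R] [CommRing S] [CommRing L]
    [Algebra R S] [Algebra R L] [Algebra S L] [IsScalarTower R S L] [Module.Finite R S]
    [Module.Finite S (integralClosure S L)] : Module.Finite R (integralClosure R L) := by
  rw [← restrictScalars_integralClosure R S L]
  exact Module.Finite.trans (R := R) S (integralClosure S L)

theorem finite_integralClosure_tower_top (R S L : Type*) [CommRing R] [CommRing S] [CommRing L]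
    [Algebra R S] [Algebra R L] [Algebra S L] [IsScalarTower R S L] [Algebra.IsIntegral R S]
    [h : Module.Finite R (integralClosure R L)] : Module.Finite S (integralClosure S L) := by
  rw [← restrictScalars_integralClosure R S L] at h
  have : Module.Finite R (integralClosure S L) := h
  exact Module.Finite.of_restrictScalars_finite R S _

theorem finite_integralClosure_of_isLocalization {R A L : Type*} [CommRing R] [CommRing A]
    [CommRing L] [Algebra R A] [Algebra R L] [Algebra A L] [IsScalarTower R A L]
    (S : Submonoid R) [IsLocalization S A] [Module.Finite R (integralClosure R L)] :
    Module.Finite A (integralClosure A L) := by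
  obtain ⟨G, hG⟩ := Module.Finite.fg_top (R := R) (M := integralClosure R L)
  have hG' : Submodule.span R ((↑) '' (G : Set (integralClosure R L)) : Set L) =
      (integralClosure R L).toSubmodule := by
    have := congrArg (Submodule.map (integralClosure R L).val.toLinearMap) hG
    rw [Submodule.map_span, Submodule.map_top] at this
    exact this.trans (SetLike.ext' Subtype.range_coe)
  refine Module.Finite.iff_fg (N := (integralClosure A L).toSubmodule) |>.mpr ?_
  classical
  refine ⟨G.image (↑), le_antisymm ?_ fun x hx ↦ ?_⟩
  · rw [Submodule.span_le]
    intro x hx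
    obtain ⟨y, -, rfl⟩ := Finset.mem_image.mp hx
    exact y.2.tower_top
  · obtain ⟨m, hm⟩ := IsIntegral.exists_multiple_integral_of_isLocalization S x hx
    have hmx : (m : R) • x ∈ Submodule.span R ((↑) '' (G : Set (integralClosure R L)) : Set L) :=
      hG' ▸ hm
    have h := Submodule.span_le_restrictScalars R A _ hmx
    rw [Submodule.restrictScalars_mem, ← algebraMap_smul A,
      Submodule.smul_mem_iff_of_isUnit _ (IsLocalization.map_units A m)] at h
    simpa using h
open MvPolynomial in
/-- The ring homomorphism `k[X] → l[X]` extending `algebraMap k l` and sending each variable to its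
`q`-th power. -/
noncomputable def MvPolynomial.mapExpand {k : Type*} (l σ : Type*) [CommRing k] [CommRing l]
    [Algebra k l] (q : ℕ) : MvPolynomial σ k →+* MvPolynomial σ l :=
  (expand q : MvPolynomial σ l →ₐ[l] _).toRingHom.comp (map (algebraMap k l))

open MvPolynomial in
theorem MvPolynomial.mapExpand_monomial {k l σ : Type*} [CommRing k] [CommRing l] [Algebra k l]
    (q : ℕ) (m : σ →₀ ℕ) (c : k) :
    mapExpand l σ q (monomial m c) = monomial (q • m) (algebraMap k l c) := by
  simp [mapExpand]

theorem MvPolynomial.mapExpand_injective {k l σ : Type*} [Field k] [CommRing l] [Nontrivial l]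
    [Algebra k l] {q : ℕ} (hq : 0 < q) : Function.Injective (mapExpand (k := k) l σ q) :=
  (expand_injective hq).comp (map_injective _ (algebraMap k l).injective)

open MvPolynomial in
theorem MvPolynomial.finite_mapExpand {k l σ : Type*} [Finite σ] [CommRing k] [CommRing l]
    [Algebra k l] [Module.Finite k l] {q : ℕ} (hq : 0 < q) : (mapExpand (k := k) l σ q).Finite := by
  have hC (c : k) : mapExpand l σ q (C c) = C (algebraMap k l c) := by simp [mapExpand]
  apply RingHom.IsIntegral.to_finite
  · intro f
    induction f using MvPolynomial.induction_on with
    | C a =>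
      obtain ⟨p, hp, hpa⟩ := Algebra.IsIntegral.isIntegral (R := k) a
      refine ⟨p.map C, hp.map _, ?_⟩
      rw [Polynomial.eval₂_map, show (mapExpand l σ q).comp C = C.comp (algebraMap k l) from
        RingHom.ext hC, ← Polynomial.hom_eval₂, hpa, map_zero]
    | add f g hf hg => exact hf.add _ hg
    | mul_X f i hf =>
      have hX : (mapExpand (k := k) l σ q).IsIntegralElem (X i ^ q) := by
        convert RingHom.isIntegralElem_map (mapExpand (k := k) l σ q) (x := X i)
        simp [mapExpand]
      let := (mapExpand (k := k) l σ q).toAlgebra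
      exact hf.mul _ (IsIntegral.of_pow hq hX)
  · apply RingHom.FiniteType.of_comp_finiteType (f := C)
    rw [show (mapExpand l σ q).comp C = C.comp (algebraMap k l) from RingHom.ext hC]
    exact RingHom.FiniteType.comp (RingHom.finiteType_algebraMap.mpr inferInstance)
      (RingHom.finiteType_algebraMap.mpr inferInstance)

open MvPolynomial in
theorem MvPolynomial.exists_pow_eq_mapExpand {k l σ : Type*} [CommRing k] [CommRing l] [Algebra k l]
    (p n : ℕ) [ExpChar l p] (f : MvPolynomial σ k)
    (hf : ∀ m ∈ f.support, ∃ d : l, d ^ p ^ n = algebraMap k l (f.coeff m)) :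
    ∃ g, g ^ p ^ n = mapExpand l σ (p ^ n) f := by
  choose! d hd using hf
  refine ⟨∑ m ∈ f.support, monomial m (d m), ?_⟩
  conv_rhs => rw [f.as_sum, map_sum]
  rw [sum_pow_char_pow]
  refine Finset.sum_congr rfl fun m hm ↦ ?_
  rw [mapExpand_monomial, monomial_pow, hd m hm]

open Polynomial in
theorem exists_splittingField_forall_exists_pow_eq {k : Type*} [Field k] (T : Finset k) {q : ℕ}
    (hq : q ≠ 0) : ∃ f : k[X], ∀ c ∈ T, ∃ d : f.SplittingField, d ^ q = algebraMap k _ c := by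
  have h0 (c : k) : (X ^ q - C c) ≠ 0 := X_pow_sub_C_ne_zero (Nat.pos_of_ne_zero hq) c
  refine ⟨∏ c ∈ T, (X ^ q - C c), fun c hc ↦ ?_⟩
  set f := ∏ c ∈ T, (X ^ q - C c)
  have hs : ((X ^ q - C c).map (algebraMap k f.SplittingField)).Splits :=
    (SplittingField.splits f).of_dvd
      (Polynomial.map_ne_zero (Finset.prod_ne_zero_iff.mpr fun c _ ↦ h0 c))
      (Polynomial.map_dvd _ (Finset.dvd_prod_of_mem _ hc))
  obtain ⟨d, hd⟩ := hs.exists_eval_eq_zero (by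
    rw [degree_map, degree_X_pow_sub_C (Nat.pos_of_ne_zero hq)]; exact_mod_cast hq)
  exact ⟨d, by simpa [sub_eq_zero] using hd⟩

theorem finite_integralClosure_of_algHom {R L E : Type*} (Q F : Type*) [CommRing R]
    [IsNoetherianRing R] [CommRing L] [Algebra R L] [CommRing Q] [IsDomain Q] [IsIntegrallyClosed Q]
    [Algebra R Q] [Module.Finite R Q] [Field F] [Algebra Q F] [IsFractionRing Q F] [Field E]
    [Algebra F E] [FiniteDimensional F E] [Algebra.IsSeparable F E] [Algebra Q E]
    [IsScalarTower Q F E] [Algebra R E] [IsScalarTower R Q E] (ψ : L →ₐ[R] E)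
    (hψ : Function.Injective ψ) : Module.Finite R (integralClosure R L) := by
  have : IsNoetherianRing Q :=
    isNoetherian_of_tower R (isNoetherian_of_isNoetherianRing_of_finite R Q)
  have : Module.Finite Q (integralClosure Q E) := IsIntegralClosure.finite Q F E _
  have := finite_integralClosure_tower_bot R Q E
  refine Module.Finite.of_injective ψ.mapIntegralClosure.toLinearMap fun x y h ↦ ?_
  exact Subtype.ext (hψ (congrArg Subtype.val h))

open Polynomial in
theorem IsSeparable.of_pow_expChar_pow {K L F Ω : Type*} [Field K] [Field L] [Field F] [Field Ω]
    [Algebra K L] [Algebra K F] [Algebra F Ω] [Algebra K Ω] [IsScalarTower K F Ω]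
    (ψ : L →ₐ[K] Ω) (p n : ℕ) [ExpChar F p] {a : L} (ha : IsSeparable K (a ^ p ^ n))
    (hp : ∀ i, ∃ d : F, d ^ p ^ n = algebraMap K F ((minpoly K (a ^ p ^ n)).coeff i)) :
    IsSeparable F (ψ a) := by
  have : ExpChar Ω p := expChar_of_injective_algebraMap (algebraMap F Ω).injective p
  have hl : (minpoly K (a ^ p ^ n)).map (algebraMap K F) ∈ lifts (iterateFrobenius F p n) := by
    rw [lifts_iff_coeff_lifts]
    intro i
    obtain ⟨d, hd⟩ := hp i
    exact ⟨d, by rw [coeff_map, ← hd, iterateFrobenius_def]⟩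
  obtain ⟨g, hg⟩ := (mem_lifts _).mp hl
  have hgs : g.Separable := by
    rw [← separable_map (iterateFrobenius F p n), hg]
    exact Separable.map ha
  refine hgs.of_dvd (minpoly.dvd F _ ?_)
  refine iterateFrobenius_inj Ω p n ?_
  rw [map_zero, aeval_def, hom_eval₂, ← RingHom.iterateFrobenius_comm, ← eval₂_map, hg,
    ← aeval_def, aeval_map_algebraMap, iterateFrobenius_def, ← map_pow, aeval_algHom_apply,
    minpoly.aeval, map_zero]

theorem exists_forall_isSeparable_pow (K L : Type*) [Field K] [Field L] [Algebra K L]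
    [FiniteDimensional K L] (p : ℕ) [ExpChar K p] : ∃ n, ∀ a : L, IsSeparable K (a ^ p ^ n) := by
  have : ExpChar (separableClosure K L) p :=
    expChar_of_injective_algebraMap (algebraMap K _).injective p
  refine ⟨IsPurelyInseparable.exponent (separableClosure K L) L, fun a ↦ ?_⟩
  obtain ⟨y, hy⟩ := IsPurelyInseparable.exponent_def' (separableClosure K L) p a
  rw [← hy]
  exact y.2

theorem MvPolynomial.finite_integralClosure (k : Type*) {σ L : Type*} (K : Type*) [Field k]
    [Finite σ] [Field K] [Algebra (MvPolynomial σ k) K] [IsFractionRing (MvPolynomial σ k) K]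
    [Field L] [Algebra (MvPolynomial σ k) L] [Algebra K L]
    [IsScalarTower (MvPolynomial σ k) K L] [FiniteDimensional K L] :
    Module.Finite (MvPolynomial σ k) (integralClosure (MvPolynomial σ k) L) := by
  classical
  let P := MvPolynomial σ k
  obtain ⟨p, hpk⟩ := ExpChar.exists k
  have : ExpChar P p := expChar_of_injective_algebraMap (algebraMap k P).injective p
  have : ExpChar K p := expChar_of_injective_algebraMap (IsFractionRing.injective P K) p
  obtain ⟨n, hn⟩ := exists_forall_isSeparable_pow K L p
  have hq : 0 < p ^ n := pow_pos (expChar_pos k p) n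
  let b := Module.finBasis K L
  have hfrac (x : K) : ∃ r s : P, s ≠ 0 ∧ x * algebraMap P K s ^ p ^ n = algebraMap P K r := by
    obtain ⟨r, s, hs, rfl⟩ := IsFractionRing.div_surjective (A := P) x
    have hs' : algebraMap P K s ≠ 0 := IsFractionRing.to_map_ne_zero_of_mem_nonZeroDivisors hs
    refine ⟨r * s ^ (p ^ n - 1), s, nonZeroDivisors.ne_zero hs, ?_⟩
    rw [map_mul, map_pow, ← mul_pow_sub_one hq.ne' (algebraMap P K s)]
    field_simp
  choose num den hden hnum using hfrac
  obtain ⟨f, hf⟩ := exists_splittingField_forall_exists_pow_eq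
    (Finset.univ.biUnion fun i ↦ (minpoly K (b i ^ p ^ n)).coeffs.biUnion fun c ↦ (num c).coeffs) hq.ne'
  let l := f.SplittingField
  let Q := MvPolynomial σ l
  let : Algebra P Q := (mapExpand l σ (p ^ n)).toAlgebra
  have : Module.Finite P Q := finite_mapExpand hq
  have hinj : Function.Injective (algebraMap P Q) := mapExpand_injective hq
  let F := FractionRing Q
  have : FaithfulSMul P F := (faithfulSMul_iff_algebraMap_injective P F).mpr
    ((IsFractionRing.injective Q F).comp hinj)
  let : Algebra K F := (IsFractionRing.lift (FaithfulSMul.algebraMap_injective P F)).toAlgebra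
  have : IsScalarTower P K F :=
    .of_algebraMap_eq fun x ↦ (IsFractionRing.lift_algebraMap _ x).symm
  have : ExpChar F p := expChar_of_injective_algebraMap (algebraMap K F).injective p
  let Ω := AlgebraicClosure F
  let ψ : L →ₐ[K] Ω := IsAlgClosed.lift
  have hsep (i) : IsSeparable F (ψ (b i)) := by
    refine .of_pow_expChar_pow ψ p n (hn _) fun j ↦ ?_
    set c := (minpoly K (b i ^ p ^ n)).coeff j
    by_cases hc0 : c = 0
    · exact ⟨0, by rw [zero_pow hq.ne', hc0, map_zero]⟩
    obtain ⟨g, hg⟩ := exists_pow_eq_mapExpand (l := l) p n (num c) fun m hm ↦ hf _ <| by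
      simp only [Finset.mem_biUnion, Finset.mem_univ, true_and]
      exact ⟨i, c, Polynomial.coeff_mem_coeffs hc0, coeff_mem_coeffs _ (by simpa using hm)⟩
    have hd : algebraMap P F (den c) ≠ 0 := by
      simpa using hden c
    refine ⟨algebraMap Q F g / algebraMap P F (den c), ?_⟩
    rw [div_pow, div_eq_iff (pow_ne_zero _ hd), ← map_pow, hg,
      IsScalarTower.algebraMap_apply P K F, ← map_pow, ← map_mul, hnum,
      ← IsScalarTower.algebraMap_apply P K F]
    rfl
  let E := IntermediateField.adjoin F (Set.range (ψ ∘ b))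
  have : Algebra.IsSeparable F E := (IntermediateField.isSeparable_adjoin_iff_isSeparable F Ω).mpr <| by
    rintro _ ⟨i, rfl⟩
    exact hsep i
  have : FiniteDimensional F E := IntermediateField.finiteDimensional_adjoin <| by
    rintro _ ⟨i, rfl⟩
    exact (hsep i).isIntegral
  have hE (x : L) : ψ x ∈ E := by
    rw [← b.sum_repr x, map_sum]
    refine sum_mem fun i _ ↦ ?_
    rw [map_smul, Algebra.smul_def, IsScalarTower.algebraMap_apply K F Ω]
    exact mul_mem (E.algebraMap_mem _) (IntermediateField.subset_adjoin _ _ ⟨i, rfl⟩)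
  let ψE : L →+* E := ψ.toRingHom.codRestrict E.toSubring hE
  let ψP : L →ₐ[P] E :=
    { ψE with
      commutes' r := Subtype.ext <| by
        change ψ (algebraMap P L r) = algebraMap F Ω (algebraMap P F r)
        rw [IsScalarTower.algebraMap_apply P K L, ψ.commutes,
          IsScalarTower.algebraMap_apply K F Ω, ← IsScalarTower.algebraMap_apply P K F] }
  have : IsScalarTower P Q E := .of_algebraMap_eq fun x ↦ by
    rw [IsScalarTower.algebraMap_apply P F E, IsScalarTower.algebraMap_apply Q F E,
      IsScalarTower.algebraMap_apply P Q F]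
  exact finite_integralClosure_of_algHom Q F ψP ψP.toRingHom.injective

theorem Algebra.FiniteType.finite_integralClosure (k B K L : Type*) [Field k] [CommRing B]
    [IsDomain B] [Algebra k B] [Algebra.FiniteType k B] [Field K] [Algebra B K]
    [IsFractionRing B K] [Field L] [Algebra B L] [Algebra K L] [IsScalarTower B K L]
    [FiniteDimensional K L] : Module.Finite B (integralClosure B L) := by
  obtain ⟨s, g, hg, hfin⟩ := exists_finite_inj_algHom_of_fg k B
  let P := MvPolynomial (Fin s) k
  let K₀ := FractionRing P
  let : Algebra P B := g.toAlgebra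
  have : Module.Finite P B := hfin
  have : FaithfulSMul P B := (faithfulSMul_iff_algebraMap_injective P B).mpr hg
  let : Algebra P K := ((algebraMap B K).comp (algebraMap P B)).toAlgebra
  have : IsScalarTower P B K := .of_algebraMap_eq' rfl
  let : Algebra P L := ((algebraMap B L).comp (algebraMap P B)).toAlgebra
  have : IsScalarTower P B L := .of_algebraMap_eq' rfl
  have : FaithfulSMul P K := .trans P B K
  let : Algebra K₀ K := FractionRing.liftAlgebra P K
  have : IsScalarTower P K₀ K := FractionRing.isScalarTower_liftAlgebra P K
  have : FiniteDimensional K₀ K := Module.Finite.of_isLocalization P B P⁰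
  let : Algebra K₀ L := ((algebraMap K L).comp (algebraMap K₀ K)).toAlgebra
  have : IsScalarTower K₀ K L := .of_algebraMap_eq' rfl
  have : FiniteDimensional K₀ L := Module.Finite.trans K L
  have : IsScalarTower P K₀ L := .of_algebraMap_eq fun x ↦ by
    rw [IsScalarTower.algebraMap_apply K₀ K L, ← IsScalarTower.algebraMap_apply P K₀ K,
      IsScalarTower.algebraMap_apply P B L, IsScalarTower.algebraMap_apply B K L,
      IsScalarTower.algebraMap_apply P B K]
  have : Module.Finite P (integralClosure P L) := MvPolynomial.finite_integralClosure k K₀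
  exact finite_integralClosure_tower_top P B L

theorem IsFractionRing.of_isLocalization_of_isFractionRing {R A K : Type*} [CommRing R] [IsDomain R]
    [CommRing A] [IsDomain A] [Algebra R A] [Field K] [Algebra R K] [Algebra A K]
    [IsScalarTower R A K] (S : Submonoid R) [IsLocalization S A] [IsFractionRing A K] :
    IsFractionRing R K := by
  have hS : S ≤ R⁰ := fun s hs ↦ mem_nonZeroDivisors_of_ne_zero fun h ↦
    (IsLocalization.map_units A ⟨s, hs⟩).ne_zero (by simp [h])
  have : FaithfulSMul R A :=
    (faithfulSMul_iff_algebraMap_injective R A).mpr (IsLocalization.injective A hS)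
  have : FaithfulSMul R K := .trans R A K
  refine .of_field R K fun z ↦ ?_
  have hmap (s : S) : algebraMap R K s ≠ 0 := by
    simpa using nonZeroDivisors.ne_zero (hS s.2)
  have hfrac (x : A) : ∃ r, ∃ s : S, algebraMap A K x = algebraMap R K r / algebraMap R K s := by
    obtain ⟨⟨r, s⟩, h⟩ := IsLocalization.surj S x
    refine ⟨r, s, (eq_div_iff (hmap s)).mpr ?_⟩
    rw [IsScalarTower.algebraMap_apply R A K, ← map_mul, h, ← IsScalarTower.algebraMap_apply]
  obtain ⟨x, y, -, rfl⟩ := IsFractionRing.div_surjective (A := A) z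
  obtain ⟨u, s, hu⟩ := hfrac x
  obtain ⟨v, t, hv⟩ := hfrac y
  exact ⟨u * t, s * v, by rw [hu, hv, div_div_div_eq, map_mul, map_mul]⟩


/-- Let `k` be a field and let `A` be a localization (at a multiplicative subset `S` of `B`)
of a finitely generated `k`-algebra `B` that is a domain. Let `K = Q(A)` be the fraction
field of `A` and let `L/K` be a finite field extension. Then the integral closure of `A` in
`L` is a finitely generated `A`-module. -/
theorem stmt_17 {k B A L : Type*} [Field k] [CommRing B] [IsDomain B] [Algebra k B]
    [Algebra.FiniteType k B] [CommRing A] [IsDomain A] [Algebra k A] [Algebra B A]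
    [IsScalarTower k B A] (S : Submonoid B) [IsLocalization S A]
    [Field L] [Algebra A L] [Algebra (FractionRing A) L]
    [IsScalarTower A (FractionRing A) L] [FiniteDimensional (FractionRing A) L] :
    Module.Finite A (integralClosure A L) := by
  let K := FractionRing A
  have : IsFractionRing B K := .of_isLocalization_of_isFractionRing (A := A) S
  let : Algebra B L := ((algebraMap A L).comp (algebraMap B A)).toAlgebra
  have : IsScalarTower B A L := .of_algebraMap_eq' rfl
  have : IsScalarTower B K L := .of_algebraMap_eq fun x ↦ by
    rw [IsScalarTower.algebraMap_apply B A K, ← IsScalarTower.algebraMap_apply A K L,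
      IsScalarTower.algebraMap_apply B A L]
  have := Algebra.FiniteType.finite_integralClosure k B K L
  exact finite_integralClosure_of_isLocalization S
end

section
/- Let M/K be a normal algebraic field extension with G = Aut_K(M), and let L, L' be intermediate fields with L/K separable. Put H = Aut_L(M) and H' = Aut_{L'}(M). Then the tensor product L ⊗_K L' is a field if and only if G = H·H' (the set of products h·h' with h ∈ H, h' ∈ H'). If moreover L/K or L'/K is normal, these conditions are also equivalent to L ∩ L' = K. -/
/-- Two embeddings of a field `T` into a normal extension `M` of `K` differ by an automorphism
of `M`. -/
theorem Normal.exists_algEquiv_comp {K T M : Type*} [Field K] [Field T] [Field M] [Algebra K T]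
    [Algebra K M] [Normal K M] (f g : T →ₐ[K] M) :
    ∃ σ : M ≃ₐ[K] M, ∀ x, σ (f x) = g x := by
  let : Algebra T M := f.toRingHom.toAlgebra
  have : IsScalarTower K T M := IsScalarTower.of_algebraMap_eq fun x => (f.commutes x).symm
  exact ⟨AlgEquiv.ofBijective (g.liftNormal M) (Algebra.IsAlgebraic.algHom_bijective _),
    fun x => g.liftNormal_commutes M x⟩

open scoped TensorProduct in
/-- If `L ⊗[K] L'` is a field, then every automorphism of `M` is a product of an automorphism
fixing `L` and one fixing `L'`. -/
theorem IntermediateField.exists_mul_of_isField_tensorProduct {K M : Type*} [Field K] [Field M]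
    [Algebra K M] [Normal K M] {L L' : IntermediateField K M} (H : IsField (L ⊗[K] L'))
    (g : M ≃ₐ[K] M) :
    ∃ h ∈ L.fixingSubgroup, ∃ h' ∈ L'.fixingSubgroup, g = h * h' := by
  let : Field (L ⊗[K] L') := H.toField
  obtain ⟨h, hh⟩ := Normal.exists_algEquiv_comp
    (Algebra.TensorProduct.productMap L.val L'.val)
    (Algebra.TensorProduct.productMap L.val ((g : M →ₐ[K] M).comp L'.val))
  refine ⟨h, ?_, h⁻¹ * g, ?_, by simp⟩
  · rw [mem_fixingSubgroup_iff]
    intro x hx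
    simpa using hh (⟨x, hx⟩ ⊗ₜ 1)
  · rw [mem_fixingSubgroup_iff]
    intro x hx
    have : h x = g x := by simpa using hh (1 ⊗ₜ ⟨x, hx⟩)
    rw [AlgEquiv.mul_apply, ← this, AlgEquiv.aut_inv, AlgEquiv.symm_apply_apply]

open Module in
/-- A separable extension `L` is linearly disjoint from `L'` as soon as the minimal polynomials of
its elements do not drop in degree over `L'`. -/
theorem IntermediateField.linearDisjoint_of_natDegree_minpoly_le {K M : Type*} [Field K] [Field M]
    [Algebra K M] (L L' : IntermediateField K M) [Algebra.IsSeparable K L]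
    (H : ∀ α ∈ L, (minpoly K α).natDegree ≤ (minpoly L' α).natDegree) :
    L.LinearDisjoint L' := by
  rw [linearDisjoint_iff']
  have : Algebra.IsIntegral K L.toSubalgebra :=
    inferInstanceAs (Algebra.IsIntegral K L)
  refine Subalgebra.LinearDisjoint.of_linearDisjoint_finite_left _ _ fun A hA _ => ?_
  obtain ⟨F, rfl⟩ : ∃ F : IntermediateField K M, F.toSubalgebra = A :=
    ⟨Algebra.IsAlgebraic.toIntermediateField A, rfl⟩
  rw [← linearDisjoint_iff']
  have hFL : F ≤ L := hA
  have : FiniteDimensional K F := inferInstanceAs (Module.Finite K F.toSubalgebra)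
  have : Algebra.IsSeparable K F :=
    Algebra.IsSeparable.of_algHom K L (inclusion hFL)
  obtain ⟨α, hα⟩ := Field.exists_primitive_element K F
  let b : PowerBasis K F := PowerBasis.ofAdjoinEqTop (Algebra.IsIntegral.isIntegral α) (by
    rw [← adjoin_simple_toSubalgebra_of_isAlgebraic (Algebra.IsAlgebraic.isAlgebraic α), hα,
      top_toSubalgebra])
  have hb : b.gen = α := PowerBasis.ofAdjoinEqTop_gen ..
  have hdim : b.dim ≤ (minpoly L' (α : M)).natDegree := by
    rw [← b.natDegree_minpoly, hb, ← minpoly.algebraMap_eq (algebraMap F M).injective α]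
    exact H _ (hFL α.2)
  refine .of_basis_left b.basis ?_
  convert (linearIndependent_pow (K := L') (α : M)).comp (Fin.castLE hdim)
    (Fin.castLE_injective hdim) using 1
  ext i
  simp [hb]

/-- If every automorphism of `M` is a product of one fixing `L` and one fixing `L'`, then minimal
polynomials of separable elements of `L` do not drop in degree over `L'`. -/
theorem IntermediateField.natDegree_minpoly_le_of_exists_mul {K M : Type*} [Field K] [Field M]
    [Algebra K M] [Normal K M] {L L' : IntermediateField K M}
    (H : ∀ g : M ≃ₐ[K] M, ∃ h ∈ L.fixingSubgroup, ∃ h' ∈ L'.fixingSubgroup, g = h * h')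
    {α : M} (hα : α ∈ L) (hs : IsSeparable K α) :
    (minpoly K α).natDegree ≤ (minpoly L' α).natDegree := by
  classical
  have hint : IsIntegral K α := Normal.isIntegral inferInstance α
  have hne : minpoly L' α ≠ 0 := minpoly.ne_zero hint.tower_top
  rw [← Polynomial.card_rootSet_eq_natDegree hs (Normal.splits inferInstance α)]
  have hsub : (minpoly K α).rootSet M ⊆ (minpoly L' α).rootSet M := by
    intro y hy
    obtain ⟨g, rfl⟩ := minpoly.exists_algEquiv_of_root' hint.isAlgebraic
      (Polynomial.mem_rootSet.1 hy).2
    obtain ⟨h, hh, h', hh', hg⟩ := H g⁻¹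
    have hgα : g α = (fixingSubgroupEquiv L' ⟨h'⁻¹, inv_mem hh'⟩) α := by
      have : h⁻¹ α = α := (IntermediateField.mem_fixingSubgroup_iff _ _).1 (inv_mem hh) α hα
      change g α = h'⁻¹ α
      rw [← inv_inv g, hg, mul_inv_rev, AlgEquiv.mul_apply, this]
    rw [Polynomial.mem_rootSet]
    refine ⟨hne, ?_⟩
    rw [hgα, Polynomial.aeval_algHom_apply, minpoly.aeval, map_zero]
  calc Fintype.card ((minpoly K α).rootSet M)
      ≤ Fintype.card ((minpoly L' α).rootSet M) := Set.card_le_card hsub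
    _ = ((minpoly L' α).aroots M).toFinset.card := by
        simp [Polynomial.rootSet_def]
    _ ≤ ((minpoly L' α).aroots M).card := Multiset.toFinset_card_le _
    _ ≤ ((minpoly L' α).map (algebraMap L' M)).natDegree := Polynomial.card_roots' _
    _ = _ := Polynomial.natDegree_map _

/-- If the coefficients of the minimal polynomial over `L'` lie in `K`, its degree is at least
that of the minimal polynomial over `K`. -/
theorem IntermediateField.natDegree_minpoly_le_of_coeff_mem_bot {K M : Type*} [Field K] [Field M]
    [Algebra K M] {L' : IntermediateField K M} {α : M} (hint : IsIntegral K α)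
    (H : ∀ i, ((minpoly L' α).coeff i : M) ∈ (⊥ : IntermediateField K M)) :
    (minpoly K α).natDegree ≤ (minpoly L' α).natDegree := by
  have hl : minpoly L' α ∈ Polynomial.lifts (algebraMap K L') := by
    rw [Polynomial.lifts_iff_coeff_lifts]
    intro i
    obtain ⟨c, hc⟩ := mem_bot.1 (H i)
    exact ⟨c, Subtype.ext hc⟩
  have hm := minpoly.monic (hint.tower_top (A := L'))
  obtain ⟨q, hq, hd, hqm⟩ := Polynomial.lifts_and_natDegree_eq_and_monic hl hm
  rw [← hd]
  refine Polynomial.natDegree_le_natDegree (minpoly.min K α hqm ?_)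
  rw [← Polynomial.aeval_map_algebraMap L', hq, minpoly.aeval]

/-- If an intermediate field `E` contains all conjugates of `α` over `K`, it contains the
coefficients of the minimal polynomial of `α` over any `L'`. -/
theorem IntermediateField.coeff_minpoly_mem_of_rootSet_subset {K M : Type*} [Field K] [Field M]
    [Algebra K M] [Normal K M] (E L' : IntermediateField K M) {α : M}
    (H : ∀ y : M, Polynomial.aeval y (minpoly K α) = 0 → y ∈ E) (i : ℕ) :
    ((minpoly L' α).coeff i : M) ∈ E := by
  have hint : IsIntegral K α := Normal.isIntegral inferInstance α
  have hl : (minpoly L' α).map (algebraMap L' M) ∈ Polynomial.lifts (algebraMap E M) := by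
    refine Polynomial.Splits.mem_lift_of_roots_mem_range (Normal.splits inferInstance α)
      ((minpoly.monic hint.tower_top).map _) _ fun y hy => ?_
    have hy' : Polynomial.aeval y (minpoly L' α) = 0 := (Polynomial.mem_aroots'.1 hy).2
    have hdvd := minpoly.dvd_map_of_isScalarTower K L' α
    have := Polynomial.aeval_eq_zero_of_dvd_aeval_eq_zero hdvd hy'
    rw [Polynomial.aeval_map_algebraMap] at this
    exact ⟨⟨y, H y this⟩, rfl⟩
  obtain ⟨c, hc⟩ := (Polynomial.lifts_iff_coeff_lifts _).1 hl i
  rw [Polynomial.coeff_map] at hc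
  have hc' : (c : M) = ((minpoly L' α).coeff i : M) := hc
  exact hc' ▸ c.2

/-- An element of a normal extension that is separable and fixed by `Aut_L(M)` lies in `L`. -/
theorem IntermediateField.mem_of_isSeparable_of_fixed {K M : Type*} [Field K] [Field M]
    [Algebra K M] [Normal K M] (L : IntermediateField K M) {x : M} (hs : IsSeparable K x)
    (H : ∀ h ∈ L.fixingSubgroup, h x = x) : x ∈ L := by
  have hx : x ∈ separableClosure L M := mem_separableClosure_iff.2 (hs.tower_top L)
  have hbot : (⟨x, hx⟩ : separableClosure L M) ∈
      (⊥ : IntermediateField L (separableClosure L M)) := by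
    rw [InfiniteGalois.mem_bot_iff_fixed]
    intro f
    have h := H _ ((fixingSubgroupEquiv L).symm (f.liftNormal M)).2
    exact Subtype.ext ((f.liftNormal_commutes M ⟨x, hx⟩).symm.trans h)
  obtain ⟨c, hc⟩ := mem_bot.1 hbot
  have hc' : (c : M) = x := congrArg Subtype.val hc
  exact hc' ▸ c.2

/-- If `L'` is normal over `K`, then automorphisms fixing `α` fix the coefficients of its minimal
polynomial over `L'`. -/
theorem IntermediateField.apply_coeff_minpoly_of_normal {K M : Type*} [Field K] [Field M]
    [Algebra K M] (L' : IntermediateField K M) [Normal K L'] {α : M}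
    (hint : IsIntegral K α) (h : M ≃ₐ[K] M) (hα : h α = α) (i : ℕ) :
    h ((minpoly L' α).coeff i : M) = ((minpoly L' α).coeff i : M) := by
  let σ : L' →+* L' := (h.restrictNormal L' : L' →+* L')
  have hσ : ∀ x : L', ((σ x : L') : M) = h x := fun x => h.restrictNormal_commutes L' x
  have hm := minpoly.monic (hint.tower_top (A := L'))
  have key : (minpoly L' α).map σ = minpoly L' α := by
    refine minpoly.unique L' α (hm.map σ) ?_ fun q hq hq0 => ?_
    · have hcomp : (algebraMap L' M).comp σ = (h : M →+* M).comp (algebraMap L' M) :=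
        RingHom.ext hσ
      rw [Polynomial.aeval_def, Polynomial.eval₂_map, hcomp]
      have := Polynomial.hom_eval₂ (minpoly L' α) (algebraMap L' M) (h : M →+* M) α
      rw [← Polynomial.aeval_def, minpoly.aeval, map_zero] at this
      rw [RingHom.coe_coe, hα] at this
      exact this.symm
    · rw [Polynomial.degree_map]
      exact minpoly.min L' α hq hq0
  rw [← hσ, ← Polynomial.coeff_map, key]

open scoped TensorProduct in
/-- Let `M/K` be a normal algebraic field extension with `G = Aut_K(M)`, and let `L, L'` be
intermediate fields with `L/K` separable. Put `H = Aut_L(M)` and `H' = Aut_{L'}(M)` (the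
fixing subgroups). Then `L ⊗_K L'` is a field iff `G = H·H'`; and if moreover `L/K` or
`L'/K` is normal, these are also equivalent to `L ∩ L' = K`. -/
theorem stmt_18 {K M : Type*} [Field K] [Field M] [Algebra K M] [Normal K M]
    (L L' : IntermediateField K M) [Algebra.IsSeparable K L] :
    (IsField (L ⊗[K] L') ↔
      ∀ g : M ≃ₐ[K] M, ∃ h ∈ L.fixingSubgroup, ∃ h' ∈ L'.fixingSubgroup, g = h * h') ∧
    ((Normal K L ∨ Normal K L') → (IsField (L ⊗[K] L') ↔ L ⊓ L' = ⊥)) := by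
  have iff_disj : IsField (L ⊗[K] L') ↔ L.LinearDisjoint L' :=
    ⟨.of_isField, fun H => H.isField_of_isAlgebraic (.inl inferInstance)⟩
  have hsep : ∀ α ∈ L, IsSeparable K α := fun α hα =>
    mem_separableClosure_iff.1 ((le_separableClosure_iff K M L).2 inferInstance hα)
  refine ⟨⟨fun H => IntermediateField.exists_mul_of_isField_tensorProduct H, fun H =>
    iff_disj.2 (L.linearDisjoint_of_natDegree_minpoly_le L' fun α hα =>
      IntermediateField.natDegree_minpoly_le_of_exists_mul H hα (hsep α hα))⟩, fun hN => ?_⟩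
  refine ⟨fun H => (iff_disj.1 H).inf_eq_bot, fun H => iff_disj.2 <|
    L.linearDisjoint_of_natDegree_minpoly_le L' fun α hα => ?_⟩
  have hint : IsIntegral K α := Normal.isIntegral inferInstance α
  refine IntermediateField.natDegree_minpoly_le_of_coeff_mem_bot hint fun i => ?_
  rw [← H]
  refine ⟨?_, ((minpoly L' α).coeff i).2⟩
  obtain hN | hN := hN
  · refine L.coeff_minpoly_mem_of_rootSet_subset L' (fun y hy => ?_) i
    obtain ⟨g, rfl⟩ := minpoly.exists_algEquiv_of_root' hint.isAlgebraic hy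
    exact IntermediateField.normal_iff_forall_map_le.1 hN (g : M →ₐ[K] M) ⟨α, hα, rfl⟩
  · refine L.mem_of_isSeparable_of_fixed ?_ fun h hh =>
      L'.apply_coeff_minpoly_of_normal hint h
        ((IntermediateField.mem_fixingSubgroup_iff _ _).1 hh α hα) i
    refine mem_separableClosure_iff.1
      ((separableClosure K M).coeff_minpoly_mem_of_rootSet_subset L' (fun y hy => ?_) i)
    obtain ⟨g, rfl⟩ := minpoly.exists_algEquiv_of_root' hint.isAlgebraic hy
    rw [mem_separableClosure_iff, IsSeparable, minpoly.algEquiv_eq]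
    exact hsep α hα
end
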